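/- Let G = (G^[i])_{i≥0} be a sequence of p×q real matrices with Σ_{i≥0} ‖G^[i]‖_op < ∞. Then for every sequence u : ℕ → ℝ^q with Σ_{n≥0} ‖u_n‖₂² = 1 (the series being summable with sum 1), the series Σ_{n=0}^∞ ‖(G∗u)(n)‖₂² converges and its sum is at least ⨅_{z ∈ ℂ, |z|=1} σ_min(Ǧ(z))², where Ǧ(z) is formed from the matrices G^[i] viewed as complex matrices. -/

import Mathlib

/-- The ℓ²→ℓ² operator norm of a matrix. -/
noncomputable def opNorm {𝕜 : Type*} [RCLike 𝕜] {m n : Type*} [Fintype m] [Fintype n]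
    [DecidableEq n] (M : Matrix m n 𝕜) : ℝ :=
  ‖LinearMap.toContinuousLinearMap (Matrix.toEuclideanLin M)‖

/-- The minimal singular value `σ_min(M)`: the infimum of `‖M v‖₂` over unit vectors `v`. -/
noncomputable def sigmaMin {𝕜 : Type*} [RCLike 𝕜] {m n : Type*} [Fintype m] [Fintype n]
    [DecidableEq n] (M : Matrix m n 𝕜) : ℝ :=
  ⨅ v : {v : EuclideanSpace 𝕜 n // ‖v‖ = 1}, ‖Matrix.toEuclideanLin M v.1‖

/-- The convolution `(G ∗ u)(k) = Σ_{i=0}^{k} G^[i] u_{k−i}` of a matrix sequence with a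
vector sequence. -/
noncomputable def conv {𝕜 : Type*} [RCLike 𝕜] {m n : Type*} [Fintype m] [Fintype n]
    [DecidableEq n] (G : ℕ → Matrix m n 𝕜) (u : ℕ → EuclideanSpace 𝕜 n) (k : ℕ) :
    EuclideanSpace 𝕜 m :=
  ∑ i ∈ Finset.range (k + 1), Matrix.toEuclideanLin (G i) (u (k - i))

/-- The Z-transform `Ǧ(z) = Σ_{i≥0} z^{−i} G^[i]` of a matrix sequence. -/
noncomputable def Zt {p q : Type*} [Fintype p] [Fintype q]
    (G : ℕ → Matrix p q ℂ) (z : ℂ) : Matrix p q ℂ :=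
  ∑' i : ℕ, z ^ (-(i : ℤ)) • G i

/-- Orthogonality of the characters of a finite cyclic group. -/
theorem sum_conj_pow_mul_pow {K : ℕ} {ζ : ℂ} (hζ : IsPrimitiveRoot ζ K) {m n : ℕ}
    (hm : m < K) (hn : n < K) :
    ∑ k ∈ Finset.range K, (starRingEnd ℂ) ((ζ ^ k) ^ m) * (ζ ^ k) ^ n =
      if m = n then (K : ℂ) else 0 := by
  have hK : K ≠ 0 := by omega
  have hz : (starRingEnd ℂ) ζ * ζ = 1 := by
    rw [Complex.conj_mul', hζ.norm'_eq_one hK]; simp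
  have hterm : ∀ k, (starRingEnd ℂ) ((ζ ^ k) ^ m) * (ζ ^ k) ^ n =
      ((starRingEnd ℂ) ζ ^ m * ζ ^ n) ^ k := by
    intro k
    simp only [map_pow, mul_pow, ← pow_mul, mul_comm k]
  simp only [hterm]
  split_ifs with h
  · subst h
    simp [← mul_pow, hz]
  · set r := (starRingEnd ℂ) ζ ^ m * ζ ^ n with hr
    have hr1 : r ≠ 1 := by
      intro h1
      apply h
      refine hζ.pow_inj hm hn ?_
      calc ζ ^ m = r * ζ ^ m := by rw [h1, one_mul]
        _ = ((starRingEnd ℂ) ζ * ζ) ^ m * ζ ^ n := by rw [hr, mul_pow]; ring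
        _ = ζ ^ n := by rw [hz, one_pow, one_mul]
    have hrK : r ^ K = 1 := by
      rw [hr, mul_pow, ← pow_mul, ← pow_mul, mul_comm m, mul_comm n, pow_mul, pow_mul, ← map_pow,
        hζ.pow_eq_one]
      simp
    rw [geom_sum_eq hr1, hrK, sub_self, zero_div]

theorem ofReal_norm_sq_eq_inner {V : Type*} [NormedAddCommGroup V] [InnerProductSpace ℂ V]
    (v : V) : (‖v‖ : ℂ) ^ 2 = inner ℂ v v :=
  (inner_self_eq_norm_sq_to_K v).symm

/-- Discrete Parseval identity for a finitely supported vector sequence. -/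
theorem card_mul_norm_sum_single_sq {F ι : Type*} [NormedAddCommGroup F] [InnerProductSpace ℂ F]
    {K : ℕ} {ζ : ℂ} (hζ : IsPrimitiveRoot ζ K) (S : Finset ι) (d : ι → ℕ) (x : ι → F)
    (hd : ∀ a ∈ S, d a < K) :
    (K : ℝ) * ‖∑ a ∈ S, lp.single (E := fun _ : ℕ => F) 2 (d a) (x a)‖ ^ 2 =
      ∑ k ∈ Finset.range K, ‖∑ a ∈ S, (ζ ^ k) ^ d a • x a‖ ^ 2 := by
  apply Complex.ofReal_injective
  push_cast
  simp only [ofReal_norm_sq_eq_inner, sum_inner, inner_sum, inner_smul_left, inner_smul_right]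
  rw [Finset.mul_sum, Finset.sum_comm]
  refine Finset.sum_congr rfl fun a ha => ?_
  simp only [Finset.mul_sum]
  rw [Finset.sum_comm]
  refine Finset.sum_congr rfl fun b hb => ?_
  rw [lp.inner_single_left, lp.single_apply]
  have hsum := sum_conj_pow_mul_pow hζ (hd b hb) (hd a ha)
  simp only [← mul_assoc, ← Finset.sum_mul]
  rw [Finset.sum_congr rfl fun k _ => mul_comm ((ζ ^ k) ^ d a) _, hsum]
  split_ifs with h
  · rw [h, Pi.single_eq_same]
  · rw [Pi.single_eq_of_ne h, inner_zero_right, mul_zero, zero_mul]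

theorem summable_norm_sq_lp {E : Type*} [NormedAddCommGroup E]
    (u : lp (fun _ : ℕ => E) 2) : Summable fun n => ‖u n‖ ^ 2 := by
  simpa using (lp.memℓp u).summable (by simp)

theorem norm_sq_lp {E : Type*} [NormedAddCommGroup E]
    (u : lp (fun _ : ℕ => E) 2) : ‖u‖ ^ 2 = ∑' n, ‖u n‖ ^ 2 := by
  simpa using lp.norm_rpow_eq_tsum (p := 2) (by simp) u

section Delay

variable {E F : Type*} [NormedAddCommGroup E] [NormedSpace ℂ E]
    [NormedAddCommGroup F] [NormedSpace ℂ F]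

theorem summable_norm_map_sq (A : E →L[ℂ] F) {u : ℕ → E} (hu : Summable fun n => ‖u n‖ ^ 2) :
    Summable fun n => ‖A (u n)‖ ^ 2 := by
  refine .of_nonneg_of_le (fun n => by positivity) (fun n => ?_) (hu.mul_left (‖A‖ ^ 2))
  rw [← mul_pow]
  gcongr
  exact A.le_opNorm _

theorem summable_norm_delay_sq (i : ℕ) (A : E →L[ℂ] F) {u : ℕ → E}
    (hu : Summable fun n => ‖u n‖ ^ 2) :
    Summable fun n => ‖if i ≤ n then A (u (n - i)) else 0‖ ^ 2 := by
  rw [← summable_nat_add_iff i]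
  simpa using summable_norm_map_sq A hu

/-- The linear map `u ↦ (A u_{n-i})_n` on `ℓ²`, with zeros in the first `i` places. -/
noncomputable def delayLM (i : ℕ) (A : E →L[ℂ] F) :
    lp (fun _ : ℕ => E) 2 →ₗ[ℂ] lp (fun _ : ℕ => F) 2 where
  toFun u := ⟨fun n => if i ≤ n then A (u (n - i)) else 0,
    memℓp_gen (by simpa using summable_norm_delay_sq i A (summable_norm_sq_lp u))⟩
  map_add' u v := by
    ext n
    change (if i ≤ n then A (u (n - i) + v (n - i)) else 0) =
      (if i ≤ n then A (u (n - i)) else 0) + if i ≤ n then A (v (n - i)) else 0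
    by_cases h : i ≤ n <;> simp [h]
  map_smul' c u := by
    ext n
    by_cases h : i ≤ n <;> simp [h]

theorem delayLM_apply (i : ℕ) (A : E →L[ℂ] F) (u : lp (fun _ : ℕ => E) 2) (n : ℕ) :
    delayLM i A u n = if i ≤ n then A (u (n - i)) else 0 := rfl

theorem norm_delayLM_apply_le (i : ℕ) (A : E →L[ℂ] F) (u : lp (fun _ : ℕ => E) 2) :
    ‖delayLM i A u‖ ≤ ‖A‖ * ‖u‖ := by
  refine (sq_le_sq₀ (by positivity) (by positivity)).1 ?_
  have hu := summable_norm_sq_lp u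
  rw [mul_pow, norm_sq_lp, norm_sq_lp, ← tsum_mul_left]
  simp only [delayLM_apply]
  rw [← (summable_norm_delay_sq i A hu).sum_add_tsum_nat_add i, Finset.sum_eq_zero, zero_add]
  · simp only [Nat.le_add_left, if_true, Nat.add_sub_cancel]
    refine Summable.tsum_le_tsum (fun n => ?_) (summable_norm_map_sq A hu) (hu.mul_left _)
    rw [← mul_pow]
    gcongr
    exact A.le_opNorm _
  · intro n hn
    simp [not_le.2 (Finset.mem_range.1 hn)]

/-- The bounded operator `u ↦ (A u_{n-i})_n` on `ℓ²`, with zeros in the first `i` places. -/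
noncomputable def delayCLM (i : ℕ) (A : E →L[ℂ] F) :
    lp (fun _ : ℕ => E) 2 →L[ℂ] lp (fun _ : ℕ => F) 2 :=
  (delayLM i A).mkContinuous ‖A‖ (norm_delayLM_apply_le i A)

theorem delayCLM_apply (i : ℕ) (A : E →L[ℂ] F) (u : lp (fun _ : ℕ => E) 2) (n : ℕ) :
    delayCLM i A u n = if i ≤ n then A (u (n - i)) else 0 := rfl

theorem norm_delayCLM_le (i : ℕ) (A : E →L[ℂ] F) : ‖delayCLM i A‖ ≤ ‖A‖ :=
  LinearMap.mkContinuous_norm_le _ (norm_nonneg _) _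

theorem delayCLM_single (i j : ℕ) (A : E →L[ℂ] F) (x : E) :
    delayCLM i A (lp.single 2 j x) = lp.single 2 (i + j) (A x) := by
  ext n
  rw [delayCLM_apply, lp.single_apply, lp.single_apply]
  by_cases h : n = i + j
  · subst h; simp
  · rw [Pi.single_eq_of_ne h]
    split_ifs with hi
    · rw [Pi.single_eq_of_ne (by omega), map_zero]
    · rfl

theorem summable_delayCLM [CompleteSpace F] {A : ℕ → E →L[ℂ] F} (hA : Summable fun i => ‖A i‖) :
    Summable fun i => delayCLM i (A i) :=
  Summable.of_norm_bounded (E := lp (fun _ : ℕ => E) 2 →L[ℂ] lp (fun _ : ℕ => F) 2) hA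
    fun i => norm_delayCLM_le i (A i)

theorem tsum_delayCLM_apply [CompleteSpace F] {A : ℕ → E →L[ℂ] F} (hA : Summable fun i => ‖A i‖)
    (u : lp (fun _ : ℕ => E) 2) (n : ℕ) :
    (∑' i, delayCLM i (A i)) u n = ∑ i ∈ Finset.range (n + 1), A i (u (n - i)) := by
  let L : (lp (fun _ : ℕ => E) 2 →L[ℂ] lp (fun _ : ℕ => F) 2) →L[ℂ] F :=
    (lp.evalCLM ℂ (fun _ : ℕ => F) 2 n).comp (ContinuousLinearMap.apply ℂ _ u)
  have h1 := L.hasSum (summable_delayCLM hA).hasSum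
  refine h1.unique ?_
  have h2 : HasSum (fun i => delayCLM i (A i) u n)
      (∑ i ∈ Finset.range (n + 1), delayCLM i (A i) u n) :=
    hasSum_sum_of_ne_finset_zero fun i hi => by
      rw [delayCLM_apply, if_neg (by simpa using hi)]
  have h3 : ∑ i ∈ Finset.range (n + 1), delayCLM i (A i) u n =
      ∑ i ∈ Finset.range (n + 1), A i (u (n - i)) :=
    Finset.sum_congr rfl fun i hi => by
      rw [delayCLM_apply, if_pos (by simpa [Nat.lt_succ_iff] using hi)]
  exact h3 ▸ h2

end Delay

section Toeplitz

variable {E F : Type*} [NormedAddCommGroup E] [InnerProductSpace ℂ E]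
    [NormedAddCommGroup F] [InnerProductSpace ℂ F]

/-- A lower bound for a matrix polynomial on the unit circle passes to finite convolutions. -/
theorem mul_norm_le_norm_sum_delayCLM {t : ℝ} (ht : 0 ≤ t) (N : ℕ) (A : ℕ → E →L[ℂ] F)
    (hA : ∀ w : ℂ, ‖w‖ = 1 → ∀ v : E, t * ‖v‖ ≤ ‖(∑ i ∈ Finset.range N, w ^ i • A i) v‖)
    (u : ℕ → E) :
    t * ‖∑ j ∈ Finset.range N, lp.single (E := fun _ : ℕ => E) 2 j (u j)‖ ≤
      ‖(∑ i ∈ Finset.range N, delayCLM i (A i))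
        (∑ j ∈ Finset.range N, lp.single (E := fun _ : ℕ => E) 2 j (u j))‖ := by
  have hexp : (∑ i ∈ Finset.range N, delayCLM i (A i))
        (∑ j ∈ Finset.range N, lp.single (E := fun _ : ℕ => E) 2 j (u j)) =
      ∑ a ∈ Finset.range N ×ˢ Finset.range N,
        lp.single (E := fun _ : ℕ => F) 2 (a.1 + a.2) (A a.1 (u a.2)) := by
    rw [Finset.sum_product]
    simp only [sum_apply, map_sum, delayCLM_single]
    exact Finset.sum_comm
  rw [hexp]
  have hK : N + N + 1 ≠ 0 := by omega
  have hζ := Complex.isPrimitiveRoot_exp (N + N + 1) hK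
  set ζ := Complex.exp (2 * Real.pi * Complex.I / ((N + N + 1 : ℕ) : ℂ))
  have h1 := card_mul_norm_sum_single_sq hζ (Finset.range N) (fun j => j) u
    (fun a ha => by have := Finset.mem_range.1 ha; omega)
  have h2 := card_mul_norm_sum_single_sq hζ (Finset.range N ×ˢ Finset.range N)
    (fun a => a.1 + a.2) (fun a => A a.1 (u a.2))
    (fun a ha => by simp only [Finset.mem_product, Finset.mem_range] at ha; omega)
  refine (sq_le_sq₀ (by positivity) (norm_nonneg _)).1 ?_
  refine le_of_mul_le_mul_left ?_ (Nat.cast_pos.2 (Nat.pos_of_ne_zero hK) : (0 : ℝ) < _)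
  rw [h2, mul_pow, mul_left_comm, h1, Finset.mul_sum]
  refine Finset.sum_le_sum fun k _ => ?_
  rw [← mul_pow]
  have hw : ‖ζ ^ k‖ = 1 := by rw [norm_pow, hζ.norm'_eq_one hK, one_pow]
  have := hA _ hw (∑ j ∈ Finset.range N, (ζ ^ k) ^ j • u j)
  gcongr
  refine this.trans_eq ?_
  rw [Finset.sum_product, Finset.sum_comm]
  simp only [sum_apply, map_sum, map_smul, smul_apply, pow_add, mul_smul, Finset.smul_sum]
  refine congrArg _ (Finset.sum_congr rfl fun j _ => Finset.sum_congr rfl fun i _ => ?_)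
  exact smul_comm _ _ _

variable [CompleteSpace F]

open Filter Topology in
/-- If the symbol of a block Toeplitz operator is bounded below on the unit circle, so is the
operator. -/
theorem mul_norm_le_norm_tsum_delayCLM {s : ℝ} (hs : 0 ≤ s) {A : ℕ → E →L[ℂ] F}
    (hA : Summable fun i => ‖A i‖)
    (hlow : ∀ w : ℂ, ‖w‖ = 1 → ∀ v : E, s * ‖v‖ ≤ ‖(∑' i, w ^ i • A i) v‖)
    (u : lp (fun _ : ℕ => E) 2) :
    s * ‖u‖ ≤ ‖(∑' i, delayCLM i (A i)) u‖ := by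
  set ε : ℕ → ℝ := fun N => ∑' i, ‖A (i + N)‖
  have hε : Tendsto ε atTop (𝓝 0) := tendsto_sum_nat_add fun i => ‖A i‖
  have hu : Tendsto (fun N => ∑ j ∈ Finset.range N, lp.single (E := fun _ : ℕ => E) 2 j (u j))
      atTop (𝓝 u) := (lp.hasSum_single (by simp) u).tendsto_sum_nat
  have hT := (summable_delayCLM hA).hasSum.tendsto_sum_nat
  have hTu := (isBoundedBilinearMap_apply (𝕜 := ℂ) (E := lp (fun _ : ℕ => E) 2)
    (F := lp (fun _ : ℕ => F) 2)).continuous.continuousAt.tendsto.comp (hT.prodMk_nhds hu)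
  have hmax : Tendsto (fun N => max (s - ε N) 0) atTop (𝓝 s) := by
    simpa [hs] using (tendsto_const_nhds (x := s) |>.sub hε).max
      (tendsto_const_nhds (x := (0 : ℝ)))
  refine le_of_tendsto_of_tendsto' (hmax.mul hu.norm) hTu.norm fun N => ?_
  refine mul_norm_le_norm_sum_delayCLM (le_max_right _ _) N A (fun w hw v => ?_) u
  rw [max_mul_of_nonneg _ _ (norm_nonneg v), zero_mul]
  refine max_le ?_ (norm_nonneg _)
  have hsumm : Summable fun i => ‖w ^ i • A i‖ := by simpa [norm_smul, hw] using hA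
  have htailsumm : Summable fun i => ‖w ^ (i + N) • A (i + N)‖ :=
    (summable_nat_add_iff (f := fun i => ‖w ^ i • A i‖) N).2 hsumm
  have htail : ‖(∑' i, w ^ (i + N) • A (i + N)) v‖ ≤ ε N * ‖v‖ := by
    refine ContinuousLinearMap.le_of_opNorm_le _ ?_ v
    refine (norm_tsum_le_tsum_norm htailsumm).trans_eq ?_
    simp only [norm_smul, norm_pow, hw, one_pow, one_mul, ε]
  have hsplit := hsumm.of_norm.sum_add_tsum_nat_add N
  have h := hlow w hw v
  rw [← hsplit, add_apply] at h
  have := norm_add_le ((∑ i ∈ Finset.range N, w ^ i • A i) v)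
    ((∑' i, w ^ (i + N) • A (i + N)) v)
  linarith

theorem summable_and_le_tsum_conv {s : ℝ} (hs : 0 ≤ s) {A : ℕ → E →L[ℂ] F}
    (hA : Summable fun i => ‖A i‖)
    (hlow : ∀ w : ℂ, ‖w‖ = 1 → ∀ v : E, s * ‖v‖ ≤ ‖(∑' i, w ^ i • A i) v‖)
    {u : ℕ → E} (hu : Summable fun n => ‖u n‖ ^ 2) :
    Summable (fun n => ‖∑ i ∈ Finset.range (n + 1), A i (u (n - i))‖ ^ 2) ∧
      s ^ 2 * ∑' n, ‖u n‖ ^ 2 ≤ ∑' n, ‖∑ i ∈ Finset.range (n + 1), A i (u (n - i))‖ ^ 2 := by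
  let U : lp (fun _ : ℕ => E) 2 := ⟨u, memℓp_gen (by simpa using hu)⟩
  have h := mul_norm_le_norm_tsum_delayCLM hs hA hlow U
  have hy : ∀ n, (∑' i, delayCLM i (A i)) U n = ∑ i ∈ Finset.range (n + 1), A i (u (n - i)) :=
    tsum_delayCLM_apply hA U
  have hU : ‖U‖ ^ 2 = ∑' n, ‖u n‖ ^ 2 := norm_sq_lp U
  have hTU := norm_sq_lp ((∑' i, delayCLM i (A i)) U)
  have hsum := summable_norm_sq_lp ((∑' i, delayCLM i (A i)) U)
  simp only [hy] at hTU hsum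
  refine ⟨hsum, ?_⟩
  rw [← hTU, ← hU, ← mul_pow]
  gcongr

end Toeplitz
section Complexification

/-- The coordinatewise inclusion of real Euclidean space into complex Euclidean space. -/
noncomputable def complexify {n : Type*} (v : EuclideanSpace ℝ n) : EuclideanSpace ℂ n :=
  WithLp.toLp 2 fun i => (v i : ℂ)

theorem norm_complexify {n : Type*} [Fintype n] (v : EuclideanSpace ℝ n) : ‖complexify v‖ = ‖v‖ := by
  simp [EuclideanSpace.norm_eq, complexify]

theorem toEuclideanLin_map_ofReal_complexify {m n : Type*} [Fintype n] [DecidableEq n]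
    (M : Matrix m n ℝ) (v : EuclideanSpace ℝ n) :
    Matrix.toEuclideanLin (M.map Complex.ofReal) (complexify v) =
      complexify (Matrix.toEuclideanLin M v) := by
  ext i
  simp [complexify, Matrix.mulVec, dotProduct]

theorem norm_sq_eq_re_add_im {n : Type*} [Fintype n] (v : EuclideanSpace ℂ n) : ‖v‖ ^ 2 =
    ‖(WithLp.toLp 2 fun i => (v i).re : EuclideanSpace ℝ n)‖ ^ 2 +
      ‖(WithLp.toLp 2 fun i => (v i).im : EuclideanSpace ℝ n)‖ ^ 2 := by
  simp only [EuclideanSpace.norm_sq_eq, ← Finset.sum_add_distrib, Complex.sq_norm,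
    Complex.normSq_apply, Real.norm_eq_abs, sq_abs, ← sq]

variable {m n : Type*} [Fintype m] [Fintype n] [DecidableEq n]

theorem norm_toEuclideanLin_le (M : Matrix m n ℝ) (v : EuclideanSpace ℝ n) :
    ‖Matrix.toEuclideanLin M v‖ ≤ opNorm M * ‖v‖ :=
  (LinearMap.toContinuousLinearMap (Matrix.toEuclideanLin M)).le_opNorm v

theorem opNorm_map_ofReal_le (M : Matrix m n ℝ) : opNorm (M.map Complex.ofReal) ≤ opNorm M := by
  refine ContinuousLinearMap.opNorm_le_bound _ (norm_nonneg _) fun v => ?_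
  change ‖Matrix.toEuclideanLin (M.map Complex.ofReal) v‖ ≤ opNorm M * ‖v‖
  have hM : 0 ≤ opNorm M := norm_nonneg _
  refine (sq_le_sq₀ (norm_nonneg _) (by positivity)).1 ?_
  rw [mul_pow, norm_sq_eq_re_add_im v, norm_sq_eq_re_add_im, mul_add, ← mul_pow, ← mul_pow]
  have hre : (WithLp.toLp 2 fun i => (Matrix.toEuclideanLin (M.map Complex.ofReal) v i).re) =
      Matrix.toEuclideanLin M (WithLp.toLp 2 fun i => (v i).re) := by
    ext i
    simp [Matrix.mulVec, dotProduct]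
  have him : (WithLp.toLp 2 fun i => (Matrix.toEuclideanLin (M.map Complex.ofReal) v i).im) =
      Matrix.toEuclideanLin M (WithLp.toLp 2 fun i => (v i).im) := by
    ext i
    simp [Matrix.mulVec, dotProduct]
  rw [hre, him]
  gcongr <;> exact norm_toEuclideanLin_le _ _

theorem sigmaMin_mul_norm_le (M : Matrix m n ℂ) (v : EuclideanSpace ℂ n) :
    sigmaMin M * ‖v‖ ≤ ‖Matrix.toEuclideanLin M v‖ := by
  rcases eq_or_ne v 0 with rfl | hv
  · simp
  have hv' : ‖v‖ ≠ 0 := norm_ne_zero_iff.2 hv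
  have h : sigmaMin M ≤ ‖Matrix.toEuclideanLin M ((‖v‖⁻¹ : ℂ) • v)‖ :=
    ciInf_le (f := fun v : {v : EuclideanSpace ℂ n // ‖v‖ = 1} => ‖Matrix.toEuclideanLin M v.1‖)
      ⟨0, by rintro _ ⟨v, rfl⟩; exact norm_nonneg _⟩
      ⟨(‖v‖⁻¹ : ℂ) • v, by simp [norm_smul, hv']⟩
  rw [map_smul, norm_smul, norm_inv, Complex.norm_real, norm_norm, inv_mul_eq_div] at h
  exact (le_div_iff₀ (by positivity)).1 h

theorem toEuclideanLin_Zt {A : ℕ → Matrix m n ℂ} (hA : Summable fun i => opNorm (A i)) {z : ℂ}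
    (hz : ‖z‖ = 1) :
    LinearMap.toContinuousLinearMap (Matrix.toEuclideanLin (Zt A z)) =
      ∑' i, z⁻¹ ^ i • LinearMap.toContinuousLinearMap (Matrix.toEuclideanLin (A i)) := by
  let Φ : Matrix m n ℂ ≃ₗ[ℂ] (EuclideanSpace ℂ n →L[ℂ] EuclideanSpace ℂ m) :=
    Matrix.toEuclideanLin.trans LinearMap.toContinuousLinearMap
  have hsum : Summable fun i => z⁻¹ ^ i • Φ (A i) :=
    .of_norm_bounded hA fun i => by simp [norm_smul, hz, Φ, opNorm]
  have h := (hsum.hasSum.map Φ.symm.toLinearMap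
    (LinearMap.continuous_of_finiteDimensional _)).tsum_eq
  change Φ (Zt A z) = ∑' i, z⁻¹ ^ i • Φ (A i)
  rw [← LinearEquiv.eq_symm_apply]
  refine Eq.trans ?_ h
  simp [Zt]

theorem norm_conv_map_ofReal (G : ℕ → Matrix m n ℝ) (u : ℕ → EuclideanSpace ℝ n) (k : ℕ) :
    ‖conv (fun i => (G i).map Complex.ofReal) (fun i => complexify (u i)) k‖ = ‖conv G u k‖ := by
  rw [← norm_complexify (conv G u k)]
  congr 1
  simp only [conv, toEuclideanLin_map_ofReal_complexify]
  ext j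
  simp [complexify]

end Complexification

/-- If `G` is a sequence of real matrices with `Σ_{i≥0} ‖G^[i]‖_op < ∞`,
then for every input sequence `u` of unit ℓ² norm (`Σ_n ‖u_n‖₂² = 1`), the series
`Σ_{n=0}^∞ ‖(G∗u)(n)‖₂²` converges and its sum is at least
`⨅_{z ∈ ℂ, |z|=1} σ_min(Ǧ(z))²` (i.e. `κ(G) ≥ min_{z ∈ 𝕋} σ_min(Ǧ(z))²`). -/
theorem stmt6 {p q : ℕ} (G : ℕ → Matrix (Fin p) (Fin q) ℝ)
    (hG : Summable fun i => opNorm (G i)) :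
    ∀ u : ℕ → EuclideanSpace ℝ (Fin q), HasSum (fun n => ‖u n‖ ^ 2) 1 →
      Summable (fun n : ℕ => ‖conv G u n‖ ^ 2) ∧
        (⨅ z : {z : ℂ // ‖z‖ = 1},
            sigmaMin (Zt (fun i => (G i).map Complex.ofReal) z.1) ^ 2) ≤
          ∑' n : ℕ, ‖conv G u n‖ ^ 2 := by
  intro u hu
  set c := ⨅ z : {z : ℂ // ‖z‖ = 1},
    sigmaMin (Zt (fun i => (G i).map Complex.ofReal) z.1) ^ 2
  have hc : 0 ≤ c := Real.iInf_nonneg fun z => sq_nonneg _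
  have hA : Summable fun i => opNorm ((G i).map Complex.ofReal) :=
    .of_nonneg_of_le (fun i => norm_nonneg _) (fun i => opNorm_map_ofReal_le (G i)) hG
  have hlow : ∀ w : ℂ, ‖w‖ = 1 → ∀ v : EuclideanSpace ℂ (Fin q), √c * ‖v‖ ≤
      ‖(∑' i, w ^ i • LinearMap.toContinuousLinearMap
        (Matrix.toEuclideanLin ((G i).map Complex.ofReal))) v‖ := by
    intro w hw v
    have hw' : ‖w⁻¹‖ = 1 := by simp [hw]
    have hZ := toEuclideanLin_Zt hA hw'
    rw [inv_inv] at hZ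
    rw [← hZ]
    refine le_trans ?_ (sigmaMin_mul_norm_le _ v)
    gcongr
    refine Real.sqrt_le_iff.2 ⟨Real.iInf_nonneg fun v => norm_nonneg _, ?_⟩
    exact ciInf_le (f := fun z : {z : ℂ // ‖z‖ = 1} =>
      sigmaMin (Zt (fun i => (G i).map Complex.ofReal) z.1) ^ 2)
      ⟨0, by rintro _ ⟨z, rfl⟩; exact sq_nonneg _⟩ ⟨w⁻¹, hw'⟩
  have hu' : HasSum (fun n => ‖complexify (u n)‖ ^ 2) 1 := by simpa only [norm_complexify] using hu
  have key := summable_and_le_tsum_conv (Real.sqrt_nonneg c) hA hlow hu'.summable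
  rw [hu'.tsum_eq, Real.sq_sqrt hc, mul_one] at key
  change Summable (fun n => ‖conv (fun i => (G i).map Complex.ofReal)
      (fun i => complexify (u i)) n‖ ^ 2) ∧ c ≤ ∑' n, ‖conv (fun i => (G i).map Complex.ofReal)
      (fun i => complexify (u i)) n‖ ^ 2 at key
  simpa only [norm_conv_map_ofReal] using key
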